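/- arXiv:2505.02981 — 4 statements merged into one kernel-verified Lean document; each statement's English description precedes it below -/
import Mathlib

section
/- For every ε > 0 there exists a constant c_ε ≥ 1, depending only on ε, such that for every R ≥ 1 and every convex function γ : [0,1] → ℝ satisfying 0 ≤ γ'_R(0) ≤ γ'_L(1) ≤ 1, there exists a finite cover 𝒥 of [0,1] by closed subintervals satisfying: (J1) every [a,b] ∈ 𝒥 has (b−a)·(γ'_L(b)−γ'_R(a)) ≤ 2R^{−1}; (J2) #𝒥 ≤ c_ε·R^{ε}·N(Γ,R^{−1}); (J3) every J ∈ 𝒥 has length |J| ≥ R^{−1}. -/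
open MeasureTheory Set
open scoped FourierTransform ENNReal

noncomputable section

/-- The plane `ℝ²` with the Euclidean norm. -/
abbrev E2 := EuclideanSpace ℝ (Fin 2)

/-- `γR` and `γL` are the one-sided derivatives of `γ` on the interval `[a,b]`:
the right derivative is defined on `[a,b)` and the left derivative on `(a,b]`. -/
def HasOneSidedDerivs (γ γR γL : ℝ → ℝ) (a b : ℝ) : Prop :=
  (∀ x ∈ Set.Ico a b, HasDerivWithinAt γ (γR x) (Set.Ioc x b) x) ∧
  (∀ x ∈ Set.Ioc a b, HasDerivWithinAt γ (γL x) (Set.Ico a x) x)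

/-- The curve `Γ = {(t, γ t) : t ∈ [0,1]} ⊆ ℝ²`. -/
def curveGraph (γ : ℝ → ℝ) : Set E2 :=
  {p : E2 | p 0 ∈ Icc (0:ℝ) 1 ∧ p 1 = γ (p 0)}

/-- The line `{x : ⟪w,x⟫ = c}` (with `w ≠ 0`) is a supporting line for `Γ`:
it meets the closure of `Γ` and `Γ` lies in one of the two closed half-planes it bounds. -/
def IsSupportingLine (γ : ℝ → ℝ) (w : E2) (c : ℝ) : Prop :=
  w ≠ 0 ∧ (∃ x ∈ closure (curveGraph γ), inner (𝕜 := ℝ) w x = c) ∧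
    ((∀ x ∈ curveGraph γ, inner (𝕜 := ℝ) w x ≤ c) ∨
      (∀ x ∈ curveGraph γ, c ≤ inner (𝕜 := ℝ) w x))

/-- The cap `B(ℓ, r)`: points of `Γ` at distance `< r` from the line
`ℓ = {x : ⟪w,x⟫ = c}`; the distance from `ξ` to `ℓ` is `|⟪w,ξ⟫ − c|/‖w‖`. -/
def cap (γ : ℝ → ℝ) (w : E2) (c r : ℝ) : Set E2 :=
  {ξ : E2 | ξ ∈ curveGraph γ ∧ |inner (𝕜 := ℝ) w ξ - c| / ‖w‖ < r}

/-- `capNumber γ r` is `N(Γ, r)`: the minimal number of caps `B(ℓ, r)` over supporting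
lines `ℓ` needed to cover `Γ`. -/
def capNumber (γ : ℝ → ℝ) (r : ℝ) : ℕ :=
  sInf {n : ℕ | ∃ (w : Fin n → E2) (c : Fin n → ℝ),
    (∀ i, IsSupportingLine γ (w i) (c i)) ∧
    curveGraph γ ⊆ ⋃ i, cap γ (w i) (c i) r}

/-- The vertical `r`-neighbourhood `N_r(Γ) = {ξ : ξ₁ ∈ [0,1], |ξ₂ − γ(ξ₁)| ≤ r}`. -/
def vnbhd (γ : ℝ → ℝ) (r : ℝ) : Set E2 :=
  {ξ : E2 | ξ 0 ∈ Icc (0:ℝ) 1 ∧ |ξ 1 - γ (ξ 0)| ≤ r}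

/-- The Fourier projection `f_J`, defined by `𝓕 f_J (ξ) = 𝓕 f (ξ) · 1_J(ξ₁)`, i.e. as the
inverse Fourier transform of the cut-off of `𝓕 f` to the vertical strip over `J`. -/
def fourierProj (f : E2 → ℂ) (J : Set ℝ) : E2 → ℂ :=
  𝓕⁻ (Set.indicator {ξ : E2 | ξ 0 ∈ J} (𝓕 f))


/-- The inequalities between difference quotients and one-sided derivatives of a convex function
on `[0,1]` whose one-sided derivatives lie in `[0,1]`. -/
structure SlopeBounds (γ γR γL : ℝ → ℝ) : Prop where
  convex : ConvexOn ℝ (Icc (0:ℝ) 1) γ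
  right_le : ∀ {x y}, 0 ≤ x → x < y → y ≤ 1 → γR x * (y - x) ≤ γ y - γ x
  le_left : ∀ {x y}, 0 ≤ x → x < y → y ≤ 1 → γ y - γ x ≤ γL y * (y - x)
  le_right : ∀ {x y}, 0 ≤ x → x < y → y < 1 → γ y - γ x ≤ γR y * (y - x)
  left_le : ∀ {x y}, 0 < x → x < y → y ≤ 1 → γL x * (y - x) ≤ γ y - γ x
  right_nonneg : ∀ {x}, 0 ≤ x → x < 1 → 0 ≤ γR x
  left_le_one : ∀ {x}, 0 < x → x ≤ 1 → γL x ≤ 1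

lemma HasOneSidedDerivs.slopeBounds {γ γR γL : ℝ → ℝ} (hc : ConvexOn ℝ (Icc (0:ℝ) 1) γ)
    (hd : HasOneSidedDerivs γ γR γL 0 1) (h0 : 0 ≤ γR 0) (h1 : γL 1 ≤ 1) :
    SlopeBounds γ γR γL := by
  have hRd : ∀ {x}, 0 ≤ x → x < 1 → HasDerivWithinAt γ (γR x) (Ioi x) x := fun {x} hx hx1 =>
    (hd.1 x ⟨hx, hx1⟩).mono_of_mem_nhdsWithin (Ioc_mem_nhdsGT hx1)
  have hLd : ∀ {x}, 0 < x → x ≤ 1 → HasDerivWithinAt γ (γL x) (Iio x) x := fun {x} hx hx1 =>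
    (hd.2 x ⟨hx, hx1⟩).mono_of_mem_nhdsWithin (Ico_mem_nhdsLT hx)
  have right_le : ∀ {x y}, 0 ≤ x → x < y → y ≤ 1 → γR x * (y - x) ≤ γ y - γ x := by
    intro x y hx hxy hy
    have := hc.le_slope_of_hasDerivWithinAt_Ioi ⟨hx, by linarith⟩ ⟨by linarith, hy⟩ hxy
      (hRd hx (by linarith))
    rwa [slope_def_field, le_div_iff₀ (by linarith)] at this
  have le_left : ∀ {x y}, 0 ≤ x → x < y → y ≤ 1 → γ y - γ x ≤ γL y * (y - x) := by
    intro x y hx hxy hy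
    have := hc.slope_le_of_hasDerivWithinAt_Iio ⟨hx, by linarith⟩ ⟨by linarith, hy⟩ hxy
      (hLd (by linarith) hy)
    rwa [slope_def_field, div_le_iff₀ (by linarith)] at this
  have le_right : ∀ {x y}, 0 ≤ x → x < y → y < 1 → γ y - γ x ≤ γR y * (y - x) := by
    intro x y hx hxy hy
    rw [← div_le_iff₀ (by linarith)]
    refine ge_of_tendsto
      ((hasDerivWithinAt_iff_tendsto_slope' self_notMem_Ioi).mp (hRd (by linarith) hy)) ?_
    filter_upwards [Ioc_mem_nhdsGT hy] with t ht
    rw [slope_def_field]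
    exact hc.slope_mono_adjacent ⟨hx, by linarith⟩ ⟨by linarith [ht.1], ht.2⟩ hxy ht.1
  have left_le : ∀ {x y}, 0 < x → x < y → y ≤ 1 → γL x * (y - x) ≤ γ y - γ x := by
    intro x y hx hxy hy
    rw [← le_div_iff₀ (by linarith)]
    refine le_of_tendsto
      ((hasDerivWithinAt_iff_tendsto_slope' self_notMem_Iio).mp (hLd hx (by linarith))) ?_
    filter_upwards [Ico_mem_nhdsLT hx] with t ht
    rw [slope_comm, slope_def_field]
    exact hc.slope_mono_adjacent ⟨ht.1, by linarith [ht.2]⟩ ⟨by linarith, hy⟩ ht.2 hxy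
  refine ⟨hc, right_le, le_left, le_right, left_le, fun {x} hx hx1 => ?_, fun {x} hx hx1 => ?_⟩
  · rcases hx.eq_or_lt with rfl | hx
    · exact h0
    · have h2 := right_le le_rfl hx hx1.le
      have h3 := le_right le_rfl hx hx1
      have h4 : γR 0 * (x - 0) ≤ γR x * (x - 0) := h2.trans h3
      exact h0.trans (le_of_mul_le_mul_right h4 (by linarith))
  · rcases hx1.eq_or_lt with rfl | hx1
    · exact h1
    · have h2 := left_le hx hx1 le_rfl
      have h3 := le_left hx.le hx1 le_rfl
      exact (le_of_mul_le_mul_right (h2.trans h3) (by linarith)).trans h1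

namespace SlopeBounds

variable {γ γR γL : ℝ → ℝ} (h : SlopeBounds γ γR γL)
include h

lemma left_mono {x y : ℝ} (hx : 0 < x) (hxy : x < y) (hy : y ≤ 1) : γL x ≤ γL y :=
  le_of_mul_le_mul_right ((h.left_le hx hxy hy).trans (h.le_left hx.le hxy hy)) (by linarith)

lemma right_mono {x y : ℝ} (hx : 0 ≤ x) (hxy : x < y) (hy : y < 1) : γR x ≤ γR y :=
  le_of_mul_le_mul_right ((h.right_le hx hxy hy.le).trans (h.le_right hx hxy hy)) (by linarith)

lemma sub_nonneg {x y : ℝ} (hx : 0 ≤ x) (hxy : x < y) (hy : y ≤ 1) : 0 ≤ γ y - γ x :=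
  (mul_nonneg (h.right_nonneg hx (by linarith)) (by linarith)).trans (h.right_le hx hxy hy)

lemma sub_le {x y : ℝ} (hx : 0 ≤ x) (hxy : x < y) (hy : y ≤ 1) : γ y - γ x ≤ y - x := by
  have h1 := h.le_left hx hxy hy
  have h2 := h.left_le_one (by linarith : 0 < y) hy
  nlinarith

lemma abs_sub_le {x y : ℝ} (hx : x ∈ Icc (0:ℝ) 1) (hy : y ∈ Icc (0:ℝ) 1) :
    |γ x - γ y| ≤ |x - y| := by
  rcases lt_trichotomy x y with hxy | rfl | hxy
  · rw [abs_sub_comm, abs_sub_comm x, abs_of_nonneg (h.sub_nonneg hx.1 hxy hy.2),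
      abs_of_pos (by linarith)]
    exact h.sub_le hx.1 hxy hy.2
  · simp
  · rw [abs_of_nonneg (h.sub_nonneg hy.1 hxy hx.2), abs_of_pos (by linarith)]
    exact h.sub_le hy.1 hxy hx.2

lemma continuousOn : ContinuousOn γ (Icc 0 1) := by
  have : LipschitzOnWith 1 γ (Icc 0 1) := LipschitzOnWith.of_dist_le_mul fun x hx y hy => by
    simpa [Real.dist_eq] using h.abs_sub_le hx hy
  exact this.continuousOn

lemma tangent_le {x y : ℝ} (hx : 0 ≤ x) (hx1 : x < 1) (hy : y ∈ Icc (0:ℝ) 1) :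
    γ x + γR x * (y - x) ≤ γ y := by
  rcases lt_trichotomy x y with hxy | rfl | hxy
  · linarith [h.right_le hx hxy hy.2]
  · simp
  · linarith [h.le_right hy.1 hxy hx1]

lemma right_le_one {x : ℝ} (hx : 0 ≤ x) (hx1 : x < 1) : γR x ≤ 1 :=
  (le_of_mul_le_mul_right ((h.right_le hx hx1 le_rfl).trans (h.le_left hx hx1 le_rfl))
    (by linarith)).trans (h.left_le_one one_pos le_rfl)

end SlopeBounds

/-- `S` is covered by at most `K` closed subintervals `[a,b]` of `[0,1]` of length at least `r`
with `(b - a) * (γL b - γR a) ≤ 2 * r`. -/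
def PieceCover (γR γL : ℝ → ℝ) (r K : ℝ) (S : Set ℝ) : Prop :=
  ∃ 𝒥 : Finset (ℝ × ℝ),
    (∀ p ∈ 𝒥, (0 ≤ p.1 ∧ p.1 ≤ p.2 ∧ p.2 ≤ 1) ∧
      (p.2 - p.1) * (γL p.2 - γR p.1) ≤ 2 * r ∧ r ≤ p.2 - p.1) ∧
    S ⊆ (⋃ p ∈ 𝒥, Icc p.1 p.2) ∧ (𝒥.card : ℝ) ≤ K

namespace PieceCover

variable {γ γR γL : ℝ → ℝ} {r : ℝ}

lemma mono {K K' : ℝ} {S T : Set ℝ} (hT : PieceCover γR γL r K T) (hK : K ≤ K') (hS : S ⊆ T) :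
    PieceCover γR γL r K' S := by
  obtain ⟨𝒥, h1, h2, h3⟩ := hT
  exact ⟨𝒥, h1, hS.trans h2, h3.trans hK⟩

lemma empty : PieceCover γR γL r 0 ∅ := ⟨∅, by simp, by simp, by simp⟩

lemma union {K K' : ℝ} {S T : Set ℝ} (hS : PieceCover γR γL r K S)
    (hT : PieceCover γR γL r K' T) : PieceCover γR γL r (K + K') (S ∪ T) := by
  classical
  obtain ⟨𝒥, h1, h2, h3⟩ := hS
  obtain ⟨𝒥', h1', h2', h3'⟩ := hT
  refine ⟨𝒥 ∪ 𝒥', fun p hp => ?_, ?_, ?_⟩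
  · exact (Finset.mem_union.mp hp).elim (h1 p) (h1' p)
  · rw [Finset.set_biUnion_union]
    exact union_subset_union h2 h2'
  · have : ((𝒥 ∪ 𝒥').card : ℝ) ≤ 𝒥.card + 𝒥'.card := by exact_mod_cast Finset.card_union_le _ _
    linarith

lemma iUnion {K : ℝ} {n : ℕ} {S : Fin n → Set ℝ} (hS : ∀ i, PieceCover γR γL r K (S i)) :
    PieceCover γR γL r (n * K) (⋃ i, S i) := by
  induction n with
  | zero => simpa using empty
  | succ n ih =>
    refine ((hS 0).union (ih fun i => hS i.succ)).mono (by push_cast; linarith) ?_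
    intro x hx
    obtain ⟨i, hi⟩ := mem_iUnion.mp hx
    refine Fin.cases (fun hi => Or.inl hi) (fun j hj => Or.inr (mem_iUnion.mpr ⟨j, hj⟩)) i hi

lemma single {p q : ℝ} (hp : 0 ≤ p) (hpq : p ≤ q) (hq : q ≤ 1)
    (hs : (q - p) * (γL q - γR p) ≤ 2 * r) (hr : r ≤ q - p) :
    PieceCover γR γL r 1 (Icc p q) :=
  ⟨{(p, q)}, by simp [*], by simp, by simp⟩

lemma of_length_le (h : SlopeBounds γ γR γL) (hr : 0 < r) (hr1 : r ≤ 1) {p q : ℝ} (hp : 0 ≤ p)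
    (hq : q ≤ 1) (hl : q - p ≤ 2 * r) : PieceCover γR γL r 1 (Icc p q) := by
  have key : ∀ {p q : ℝ}, 0 ≤ p → q ≤ 1 → r ≤ q - p → q - p ≤ 2 * r →
      PieceCover γR γL r 1 (Icc p q) := by
    intro p q hp hq h1 h2
    refine single hp (by linarith) hq ?_ h1
    have h3 := h.left_le_one (by linarith : 0 < q) hq
    have h4 := h.right_nonneg hp (by linarith : p < 1)
    nlinarith
  rcases le_or_gt r (q - p) with h1 | h1
  · exact key hp hq h1 hl
  · have h2 : min p (1 - r) ≤ p := min_le_left _ _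
    have h3 : min p (1 - r) ≤ 1 - r := min_le_right _ _
    refine (key (p := min p (1 - r)) (q := min p (1 - r) + r) (le_min hp (by linarith))
      (by linarith) (by linarith) (by linarith)).mono le_rfl (Icc_subset_Icc h2 ?_)
    rcases min_cases p (1 - r) with ⟨h4, _⟩ | ⟨h4, _⟩ <;> rw [h4] <;> linarith

lemma of_mul_le (h : SlopeBounds γ γR γL) (hr : 0 < r) (hr1 : r ≤ 1) (k : ℕ) :
    ∀ {p q : ℝ}, 0 ≤ p → q ≤ 1 → p ≤ q → (q - p) * (γL q - γR p) ≤ 2 ^ k * (2 * r) →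
      PieceCover γR γL r (2 ^ k) (Icc p q) := by
  induction k with
  | zero =>
    intro p q hp hq hpq hs
    rw [pow_zero]
    rcases le_or_gt (q - p) (2 * r) with h1 | h1
    · exact of_length_le h hr hr1 hp hq h1
    · exact single hp hpq hq (by linarith) (by linarith)
  | succ k ih =>
    intro p q hp hq hpq hs
    rcases le_or_gt (q - p) (2 * r) with h1 | h1
    · exact (of_length_le h hr hr1 hp hq h1).mono (one_le_pow₀ one_le_two) subset_rfl
    · obtain ⟨m, hm⟩ : ∃ m, m = (p + q) / 2 := ⟨_, rfl⟩
      have hL := h.left_mono (by linarith : 0 < m) (by linarith : m < q) hq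
      have hR := h.right_mono hp (by linarith : p < m) (by linarith)
      rw [pow_succ] at hs
      have e1 : (m - p) * (γL m - γR p) ≤ 2 ^ k * (2 * r) := by
        have : (m - p) * (γL m - γR p) ≤ (m - p) * (γL q - γR p) :=
          mul_le_mul_of_nonneg_left (by linarith) (by linarith)
        have e : (m - p) * (γL q - γR p) = (q - p) * (γL q - γR p) / 2 := by rw [hm]; ring
        linarith
      have e2 : (q - m) * (γL q - γR m) ≤ 2 ^ k * (2 * r) := by
        have : (q - m) * (γL q - γR m) ≤ (q - m) * (γL q - γR p) :=
          mul_le_mul_of_nonneg_left (by linarith) (by linarith)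
        have e : (q - m) * (γL q - γR p) = (q - p) * (γL q - γR p) / 2 := by rw [hm]; ring
        linarith
      refine ((ih hp (by linarith) (by linarith) e1).union
        (ih (by linarith) hq (by linarith) e2)).mono (by rw [pow_succ]; linarith) ?_
      rw [Icc_union_Icc_eq_Icc (by linarith) (by linarith)]

lemma middle_of_near_affine (h : SlopeBounds γ γR γL) (hr : 0 < r) (hr1 : r ≤ 1) {a b s d : ℝ}
    (ha : 0 ≤ a) (hb : b ≤ 1) (hab : a < b)
    (hg : ∀ t ∈ Icc a b, |γ t - s * t - d| ≤ 6 * r) (n : ℕ) :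
    PieceCover γR γL r (32 * n + 1)
      (Icc (a + (b - a) / 2 ^ (n + 1)) (b - (b - a) / 2 ^ (n + 1))) := by
  induction n with
  | zero =>
    refine (of_length_le h hr hr1 ?_ ?_ ?_).mono (by simp) subset_rfl <;> norm_num <;> linarith
  | succ n ih =>
    obtain ⟨u, hu⟩ : ∃ u, u = (b - a) / 2 ^ (n + 1) := ⟨_, rfl⟩
    have hu2 : (b - a) / 2 ^ (n + 1 + 1) = u / 2 := by rw [hu, pow_succ _ (n + 1)]; field_simp
    have hu0 : 0 < u := by rw [hu]; exact div_pos (by linarith) (by positivity)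
    have hul : 2 * u ≤ b - a := by
      rw [hu, pow_succ, ← mul_div_assoc, div_le_iff₀ (by positivity)]
      nlinarith [one_le_pow₀ (one_le_two (α := ℝ)) (n := n)]
    rw [hu2]
    rw [← hu] at ih
    have gb := abs_le.mp (hg b ⟨hab.le, le_rfl⟩)
    have ga := abs_le.mp (hg a ⟨le_rfl, hab.le⟩)
    have e1 : (a + u - (a + u / 2)) * (γL (a + u) - γR (a + u / 2)) ≤ 2 ^ 4 * (2 * r) := by
      have h1 := h.left_le (x := a + u) (y := b) (by linarith) (by linarith) hb
      have h2 := h.le_right (x := a) (y := a + u / 2) ha (by linarith) (by linarith)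
      have g1 := abs_le.mp (hg (a + u) ⟨by linarith, by linarith⟩)
      have g2 := abs_le.mp (hg (a + u / 2) ⟨by linarith, by linarith⟩)
      have h3 : (γL (a + u) - s) * (b - (a + u)) ≤ 12 * r := by linarith
      have h4 : -(12 * r) ≤ (γR (a + u / 2) - s) * (u / 2) := by linarith
      have h5 : (γL (a + u) - s) * u ≤ 12 * r := by
        rcases le_total 0 (γL (a + u) - s) with h6 | h6 <;> nlinarith
      linarith
    have e2 : (b - u / 2 - (b - u)) * (γL (b - u / 2) - γR (b - u)) ≤ 2 ^ 4 * (2 * r) := by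
      have h1 := h.left_le (x := b - u / 2) (y := b) (by linarith) (by linarith) hb
      have h2 := h.le_right (x := a) (y := b - u) ha (by linarith) (by linarith)
      have g1 := abs_le.mp (hg (b - u) ⟨by linarith, by linarith⟩)
      have g2 := abs_le.mp (hg (b - u / 2) ⟨by linarith, by linarith⟩)
      have h3 : -(12 * r) ≤ (γR (b - u) - s) * (b - u - a) := by linarith
      have h4 : (γL (b - u / 2) - s) * (u / 2) ≤ 12 * r := by linarith
      have h5 : -(12 * r) ≤ (γR (b - u) - s) * u := by
        rcases le_total 0 (γR (b - u) - s) with h6 | h6 <;> nlinarith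
      linarith
    have c1 := of_mul_le h hr hr1 4 (by linarith) (by linarith) (by linarith) e1
    have c2 := of_mul_le h hr hr1 4 (by linarith) (by linarith) (by linarith) e2
    refine ((c1.union ih).union c2).mono (by push_cast; linarith) ?_
    rw [Icc_union_Icc_eq_Icc (by linarith) (by linarith),
      Icc_union_Icc_eq_Icc (by linarith) (by linarith)]

lemma of_near_affine (h : SlopeBounds γ γR γL) (hr : 0 < r) (hr1 : r ≤ 1) {a b s d : ℝ}
    (ha : 0 ≤ a) (hb : b ≤ 1) (hab : a ≤ b)
    (hg : ∀ t ∈ Icc a b, |γ t - s * t - d| ≤ 6 * r) :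
    PieceCover γR γL r (32 * (Real.log r⁻¹ / Real.log 2) + 3) (Icc a b) := by
  have hlog : 0 ≤ Real.log r⁻¹ / Real.log 2 :=
    div_nonneg (Real.log_nonneg (one_le_inv₀ hr |>.mpr hr1)) (Real.log_nonneg one_le_two)
  rcases le_or_gt (b - a) (2 * r) with h1 | h1
  · exact (of_length_le h hr hr1 ha hb h1).mono (by linarith) subset_rfl
  · have h2 : 1 ≤ (b - a) / (2 * r) := by rw [le_div_iff₀ (by linarith)]; linarith
    obtain ⟨n, hn1, hn2⟩ := exists_nat_pow_near h2 (one_lt_two (α := ℝ))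
    obtain ⟨u, hu⟩ : ∃ u, u = (b - a) / 2 ^ (n + 1) := ⟨_, rfl⟩
    have hu0 : 0 < u := by rw [hu]; exact div_pos (by linarith) (by positivity)
    have hul : 2 * u ≤ b - a := by
      rw [hu, pow_succ, ← mul_div_assoc, div_le_iff₀ (by positivity)]
      nlinarith [one_le_pow₀ (one_le_two (α := ℝ)) (n := n)]
    have hur : u ≤ 2 * r := by
      rw [hu, div_le_iff₀ (by positivity)]
      rw [div_lt_iff₀ (by linarith)] at hn2
      linarith
    have hm := middle_of_near_affine h hr hr1 ha hb (by linarith) hg n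
    rw [← hu] at hm
    have hl := of_length_le h hr hr1 (p := a) (q := a + u) ha (by linarith) (by linarith)
    have hl' := of_length_le h hr hr1 (p := b - u) (q := b) (by linarith) hb (by linarith)
    have hn : (n : ℝ) ≤ Real.log r⁻¹ / Real.log 2 := by
      rw [le_div_iff₀ (Real.log_pos one_lt_two), ← Real.log_pow]
      refine Real.log_le_log (by positivity) (hn1.trans ?_)
      rw [div_le_iff₀ (by linarith), mul_comm 2 r, ← mul_assoc, inv_mul_cancel₀ hr.ne']
      linarith
    refine ((hl.union hm).union hl').mono (by linarith) ?_
    rw [Icc_union_Icc_eq_Icc (by linarith) (by linarith),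
      Icc_union_Icc_eq_Icc (by linarith) (by linarith)]

lemma of_subset_near_affine_of_monotone (h : SlopeBounds γ γR γL) (hr : 0 < r) (hr1 : r ≤ 1)
    {a b s d : ℝ} (ha : 0 ≤ a) (hb : b ≤ 1)
    (hm : MonotoneOn (fun t => γ t - s * t) (Icc a b) ∨
      AntitoneOn (fun t => γ t - s * t) (Icc a b)) :
    PieceCover γR γL r (32 * (Real.log r⁻¹ / Real.log 2) + 3)
      {t ∈ Icc a b | |γ t - s * t - d| ≤ 6 * r} := by
  set S := {t ∈ Icc a b | |γ t - s * t - d| ≤ 6 * r}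
  have hcont : ContinuousOn (fun t => |γ t - s * t - d|) (Icc a b) := by
    have := h.continuousOn.mono (Icc_subset_Icc ha hb)
    fun_prop
  have hcomp : IsCompact S :=
    isCompact_Icc.of_isClosed_subset (hcont.preimage_isClosed_of_isClosed isClosed_Icc isClosed_Iic)
      fun t ht => ht.1
  rcases S.eq_empty_or_nonempty with he | hne
  · rw [he]
    refine empty.mono ?_ subset_rfl
    have : 0 ≤ Real.log r⁻¹ / Real.log 2 :=
      div_nonneg (Real.log_nonneg (one_le_inv₀ hr |>.mpr hr1)) (Real.log_nonneg one_le_two)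
    linarith
  · obtain ⟨x, hxS, hx⟩ := hcomp.exists_isLeast hne
    obtain ⟨y, hyS, hy⟩ := hcomp.exists_isGreatest hne
    refine (of_near_affine h hr hr1 (a := x) (b := y) (s := s) (d := d) (ha.trans hxS.1.1)
      (hyS.1.2.trans hb) (hx hyS) fun t ht => ?_).mono le_rfl fun t ht => ⟨hx ht, hy ht⟩
    have htm : t ∈ Icc a b := ⟨hxS.1.1.trans ht.1, ht.2.trans hyS.1.2⟩
    have hx' := abs_le.mp hxS.2
    have hy' := abs_le.mp hyS.2
    rw [abs_le]
    rcases hm with hm | hm <;>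
    · have h1 := hm hxS.1 htm ht.1
      have h2 := hm htm hyS.1 ht.2
      simp only at h1 h2
      constructor <;> linarith

lemma of_sublevel (h : SlopeBounds γ γR γL) (hr : 0 < r) (hr1 : r ≤ 1) (s d : ℝ) :
    PieceCover γR γL r (2 * (32 * (Real.log r⁻¹ / Real.log 2) + 3))
      {t ∈ Icc 0 1 | |γ t - s * t - d| ≤ 6 * r} := by
  have hconv : ConvexOn ℝ (Icc (0:ℝ) 1) (fun t => γ t - s * t) := by
    refine h.convex.sub ⟨convex_Icc 0 1, fun x _ y _ p q _ _ _ => ?_⟩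
    simp only [smul_eq_mul]
    linarith
  have hcont : ContinuousOn (fun t => γ t - s * t) (Icc 0 1) := by
    have := h.continuousOn
    fun_prop
  obtain ⟨m, hm, hmin⟩ := isCompact_Icc.exists_isMinOn (nonempty_Icc.mpr zero_le_one) hcont
  have hanti : AntitoneOn (fun t => γ t - s * t) (Icc 0 m) := by
    intro x hx y hy hxy
    have hx1 : x ∈ Icc (0:ℝ) 1 := ⟨hx.1, hx.2.trans hm.2⟩
    refine (hconv.le_max_of_mem_Icc hx1 hm ⟨hxy, hy.2⟩).trans (max_le le_rfl (hmin hx1))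
  have hmono : MonotoneOn (fun t => γ t - s * t) (Icc m 1) := by
    intro x hx y hy hxy
    have hy1 : y ∈ Icc (0:ℝ) 1 := ⟨hm.1.trans hy.1, hy.2⟩
    refine (hconv.le_max_of_mem_Icc hm hy1 ⟨hx.1, hxy⟩).trans (max_le (hmin hy1) le_rfl)
  refine ((of_subset_near_affine_of_monotone h hr hr1 (d := d) le_rfl hm.2 (Or.inr hanti)).union
    (of_subset_near_affine_of_monotone h hr hr1 (d := d) hm.1 le_rfl (Or.inl hmono))).mono
    (by linarith) ?_
  rintro t ⟨ht, hb⟩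
  rcases le_total t m with htm | htm
  · exact Or.inl ⟨⟨ht.1, htm⟩, hb⟩
  · exact Or.inr ⟨⟨htm, ht.2⟩, hb⟩

lemma of_strip (h : SlopeBounds γ γR γL) (hr : 0 < r) (hr1 : r ≤ 1) {u v N : ℝ} (c : ℝ)
    (hN : N ≤ |u| + |v|) (huv : 0 < |u| + |v|) :
    PieceCover γR γL r (64 * (Real.log r⁻¹ / Real.log 2) + 8)
      {t ∈ Icc 0 1 | |u * t + v * γ t - c| < r * N} := by
  have hlog : 0 ≤ Real.log r⁻¹ / Real.log 2 :=
    div_nonneg (Real.log_nonneg (one_le_inv₀ hr |>.mpr hr1)) (Real.log_nonneg one_le_two)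
  rcases le_or_gt |u| (2 * |v|) with hle | hlt
  · have hv : 0 < |v| := by linarith
    have hv0 : v ≠ 0 := abs_pos.mp hv
    refine (of_sublevel h hr hr1 (-u / v) (c / v)).mono (by linarith) ?_
    rintro t ⟨ht, hlt⟩
    refine ⟨ht, ?_⟩
    have e : γ t - -u / v * t - c / v = (u * t + v * γ t - c) / v := by field_simp; ring
    rw [e, abs_div, div_le_iff₀ hv]
    nlinarith
  · rcases Set.eq_empty_or_nonempty {t ∈ Icc 0 1 | |u * t + v * γ t - c| < r * N} with he | hne
    · rw [he]
      exact empty.mono (by linarith) subset_rfl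
    · obtain ⟨x, hx, hxc⟩ := hne
      have hp : max 0 (x - 6 * r) ≤ x := max_le hx.1 (by linarith)
      have hq : x ≤ min 1 (x + 6 * r) := le_min hx.2 (by linarith)
      have hp' : x - 6 * r ≤ max 0 (x - 6 * r) := le_max_right _ _
      have hq' : min 1 (x + 6 * r) ≤ x + 6 * r := min_le_right _ _
      have hp0 : 0 ≤ max 0 (x - 6 * r) := le_max_left _ _
      have hq1 : min 1 (x + 6 * r) ≤ 1 := min_le_left _ _
      have hpl : max 0 (x - 6 * r) < min 1 (x + 6 * r) :=
        max_lt (lt_min one_pos (by linarith [hx.1])) (lt_min (by linarith [hx.2]) (by linarith))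
      refine (of_mul_le h hr hr1 3 hp0 hq1 hpl.le ?_).mono (by linarith) ?_
      · have h3 := h.left_le_one (hp0.trans_lt hpl) hq1
        have h4 := h.right_nonneg hp0 (hpl.trans_le hq1)
        nlinarith
      · rintro t ⟨ht, htc⟩
        have h1 : |u * (t - x)| ≤ |v| * |t - x| + 2 * (r * N) := by
          have e : u * (t - x) = (u * t + v * γ t - c) - (u * x + v * γ x - c)
              - v * (γ t - γ x) := by ring
          have h2 : |v * (γ t - γ x)| ≤ |v| * |t - x| := by
            rw [abs_mul]
            exact mul_le_mul_of_nonneg_left (h.abs_sub_le ht hx) (abs_nonneg v)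
          rw [e]
          have h5 := abs_sub ((u * t + v * γ t - c) - (u * x + v * γ x - c)) (v * (γ t - γ x))
          have h6 := abs_sub (u * t + v * γ t - c) (u * x + v * γ x - c)
          linarith
        rw [abs_mul] at h1
        have h7 : |t - x| ≤ 6 * r := by
          have hu : 0 < |u| := by linarith [abs_nonneg v]
          have h8 : |u| * |t - x| ≤ |u| * (6 * r) := by nlinarith [abs_nonneg (t - x)]
          exact le_of_mul_le_mul_left h8 hu
        have h9 := abs_le.mp h7
        exact ⟨max_le ht.1 (by linarith), le_min ht.2 (by linarith)⟩

end PieceCover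

lemma inner_E2 (w x : E2) : inner (𝕜 := ℝ) w x = w 0 * x 0 + w 1 * x 1 := by
  simp [PiLp.inner_apply, Fin.sum_univ_two, mul_comm]

lemma norm_E2_le (w : E2) : ‖w‖ ≤ |w 0| + |w 1| := by
  refine abs_le_of_sq_le_sq' ?_ (by positivity) |>.2
  rw [EuclideanSpace.real_norm_sq_eq, Fin.sum_univ_two]
  nlinarith [sq_abs (w 0), sq_abs (w 1), mul_nonneg (abs_nonneg (w 0)) (abs_nonneg (w 1))]

/-- Finitely many caps cover the graph. -/
lemma SlopeBounds.exists_cap_cover {γ γR γL : ℝ → ℝ} (h : SlopeBounds γ γR γL) {r : ℝ}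
    (hr : 0 < r) :
    {n : ℕ | ∃ (w : Fin n → E2) (c : Fin n → ℝ), (∀ i, IsSupportingLine γ (w i) (c i)) ∧
      curveGraph γ ⊆ ⋃ i, cap γ (w i) (c i) r}.Nonempty := by
  obtain ⟨n, hn⟩ := exists_nat_one_div_lt hr
  have hn0 : (0:ℝ) < (n:ℝ) + 1 := by positivity
  let x : Fin (n + 1) → ℝ := fun i => i / ((n:ℝ) + 1)
  have hx0 : ∀ i, 0 ≤ x i := fun i => by positivity
  have hx1 : ∀ i, x i < 1 := fun i => by
    rw [div_lt_one hn0]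
    exact_mod_cast i.2
  refine ⟨n + 1, fun i => !₂[-γR (x i), 1], fun i => γ (x i) - γR (x i) * x i,
    fun i => ⟨fun h0 => ?_, ⟨!₂[x i, γ (x i)], ?_, ?_⟩, Or.inr fun y hy => ?_⟩, fun y hy => ?_⟩
  · simpa using congrArg (fun v : E2 => v 1) h0
  · exact subset_closure ⟨⟨by simpa using hx0 i, by simpa using (hx1 i).le⟩, by simp⟩
  · rw [inner_E2]
    simp
    ring
  · rw [inner_E2, hy.2]
    have := h.tangent_le (hx0 i) (hx1 i) hy.1
    simp
    linarith
  · obtain ⟨i, hi1, hi2⟩ : ∃ i : Fin (n + 1), x i ≤ y 0 ∧ y 0 ≤ x i + 1 / ((n:ℝ) + 1) := by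
      rcases hy.1.2.eq_or_lt with h1 | h1
      · refine ⟨Fin.last n, ?_, ?_⟩
        · rw [h1]; exact (hx1 _).le
        · rw [h1, ← add_div, Fin.val_last, div_self hn0.ne']
      · have h0 : 0 ≤ y 0 * ((n:ℝ) + 1) := mul_nonneg hy.1.1 hn0.le
        refine ⟨⟨⌊y 0 * ((n:ℝ) + 1)⌋₊, ?_⟩, ?_, ?_⟩
        · rw [Nat.floor_lt h0]
          push_cast
          nlinarith
        · rw [div_le_iff₀ hn0]
          exact Nat.floor_le h0
        · rw [← add_div, le_div_iff₀ hn0]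
          exact (Nat.lt_floor_add_one _).le
    refine mem_iUnion.mpr ⟨i, hy, ?_⟩
    have hw : 1 ≤ ‖(!₂[-γR (x i), 1] : E2)‖ := by
      have := PiLp.norm_apply_le (!₂[-γR (x i), 1] : E2) 1
      simpa using this
    have hnum : |inner ℝ (!₂[-γR (x i), 1] : E2) y - (γ (x i) - γR (x i) * x i)| < r := by
      rw [inner_E2, hy.2]
      have h1 := h.tangent_le (hx0 i) (hx1 i) hy.1
      have h2 := h.right_nonneg (hx0 i) (hx1 i)
      have h3 := (le_abs_self _).trans
        (h.abs_sub_le hy.1 ⟨hx0 i, (hx1 i).le⟩)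
      rw [abs_of_nonneg (_root_.sub_nonneg.mpr hi1)] at h3
      simp only [Matrix.cons_val_zero, Matrix.cons_val_one]
      rw [abs_of_nonneg (by linarith)]
      nlinarith
    exact (div_le_self (abs_nonneg _) hw).trans_lt hnum

lemma SlopeBounds.pieceCover {γ γR γL : ℝ → ℝ} (h : SlopeBounds γ γR γL) {r : ℝ}
    (hr : 0 < r) (hr1 : r ≤ 1) :
    PieceCover γR γL r (capNumber γ r * (64 * (Real.log r⁻¹ / Real.log 2) + 8)) (Icc 0 1) := by
  obtain ⟨w, c, hw, hcov⟩ := Nat.sInf_mem (h.exists_cap_cover hr)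
  refine (PieceCover.iUnion fun i => PieceCover.of_strip h hr hr1 (u := w i 0) (v := w i 1)
    (c i) (norm_E2_le (w i)) ((norm_pos_iff.mpr (hw i).1).trans_le (norm_E2_le (w i)))).mono
    le_rfl fun t ht => ?_
  have hmem : (!₂[t, γ t] : E2) ∈ curveGraph γ := ⟨by simpa using ht, by simp⟩
  obtain ⟨i, -, hi⟩ := mem_iUnion.mp (hcov hmem)
  refine mem_iUnion.mpr ⟨i, ht, ?_⟩
  rw [div_lt_iff₀ (norm_pos_iff.mpr (hw i).1), inner_E2] at hi
  simpa using hi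

theorem statement_1 (ε : ℝ) (hε : 0 < ε) :
    ∃ cε : ℝ, 1 ≤ cε ∧
      ∀ R : ℝ, 1 ≤ R → ∀ γ γR γL : ℝ → ℝ,
        ConvexOn ℝ (Icc (0:ℝ) 1) γ →
        HasOneSidedDerivs γ γR γL 0 1 →
        0 ≤ γR 0 → γR 0 ≤ γL 1 → γL 1 ≤ 1 →
        ∃ 𝒥 : Finset (ℝ × ℝ),
          (∀ p ∈ 𝒥, 0 ≤ p.1 ∧ p.1 ≤ p.2 ∧ p.2 ≤ 1) ∧
          (Icc (0:ℝ) 1 ⊆ ⋃ p ∈ 𝒥, Icc p.1 p.2) ∧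
          (∀ p ∈ 𝒥, (p.2 - p.1) * (γL p.2 - γR p.1) ≤ 2 / R) ∧
          ((𝒥.card : ℝ) ≤ cε * R ^ ε * (capNumber γ R⁻¹ : ℝ)) ∧
          (∀ p ∈ 𝒥, R⁻¹ ≤ p.2 - p.1) := by
  have hlog2 : 0 < Real.log 2 := Real.log_pos one_lt_two
  refine ⟨64 / (ε * Real.log 2) + 8, ?_, ?_⟩
  · have : 0 < 64 / (ε * Real.log 2) := by positivity
    linarith
  intro R hR γ γR γL hc hd h0 _ h1
  have hR0 : 0 < R := by linarith
  obtain ⟨𝒥, hJ, hcov, hcard⟩ :=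
    (hd.slopeBounds hc h0 h1).pieceCover (inv_pos.mpr hR0) (inv_le_one_of_one_le₀ hR)
  refine ⟨𝒥, fun p hp => (hJ p hp).1, hcov, fun p hp => ?_, hcard.trans ?_,
    fun p hp => (hJ p hp).2.2⟩
  · rw [div_eq_mul_inv]
    exact (hJ p hp).2.1
  · rw [mul_comm (capNumber γ R⁻¹ : ℝ), inv_inv]
    refine mul_le_mul_of_nonneg_right ?_ (Nat.cast_nonneg _)
    have h2 : Real.log R / Real.log 2 ≤ R ^ ε / ε / Real.log 2 :=
      div_le_div_of_nonneg_right (Real.log_le_rpow_div hR0.le hε) hlog2.le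
    have h3 : 1 ≤ R ^ ε := Real.one_le_rpow hR hε.le
    have h4 : 64 / (ε * Real.log 2) * R ^ ε = 64 * (R ^ ε / ε / Real.log 2) := by field_simp
    rw [add_mul, h4]
    linarith

end
end

section
/- Let γ : [0,1] → ℝ be convex with 0 ≤ γ'_R(0) ≤ γ'_L(1) ≤ 1, let 0 < δ ≤ 1, let P ≥ 2 be an integer, and let 0 = s₀ < s₁ < ⋯ < s_{P−1} < s_P = 1. Suppose that for every p with 0 ≤ p ≤ P−2 and every η > 0 with s_{p+1} + η ≤ 1 one has A(Γ,[s_p, s_{p+1}+η]) > δ. Then (P−1)·δ ≤ 2; in particular P ≤ 3/δ. -/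
open Set

/-- `segA γR γL a b` is the quantity `A(Γ,[a,b]) = (γ'_L(b) − γ'_R(a))/(1 + γ'_L(b)·γ'_R(a))`. -/
noncomputable def segA (γR γL : ℝ → ℝ) (a b : ℝ) : ℝ :=
  (γL b - γR a) / (1 + γL b * γR a)

open Filter Topology

namespace HasOneSidedDerivs

variable {γ γR γL : ℝ → ℝ} {a b x y c : ℝ}

theorem hasDerivWithinAt_Ioi (h : HasOneSidedDerivs γ γR γL a b) (hx : x ∈ Ico a b) :
    HasDerivWithinAt γ (γR x) (Ioi x) x :=
  (HasDerivWithinAt.Ioi_iff_Ioo hx.2).1 ((h.1 x hx).mono Ioo_subset_Ioc_self)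

theorem hasDerivWithinAt_Iio (h : HasOneSidedDerivs γ γR γL a b) (hx : x ∈ Ioc a b) :
    HasDerivWithinAt γ (γL x) (Iio x) x :=
  (h.2 x hx).mono_of_mem_nhdsWithin (Ico_mem_nhdsLT hx.1)

theorem right_le_left (h : HasOneSidedDerivs γ γR γL a b) (hconv : ConvexOn ℝ (Icc a b) γ)
    (hax : a ≤ x) (hxy : x < y) (hyb : y ≤ b) : γR x ≤ γL y :=
  have hx : x ∈ Icc a b := ⟨hax, hxy.le.trans hyb⟩
  have hy : y ∈ Icc a b := ⟨hax.trans hxy.le, hyb⟩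
  (hconv.le_slope_of_hasDerivWithinAt_Ioi hx hy hxy
    (h.hasDerivWithinAt_Ioi ⟨hax, hxy.trans_le hyb⟩)).trans
  (hconv.slope_le_of_hasDerivWithinAt_Iio hx hy hxy
    (h.hasDerivWithinAt_Iio ⟨hax.trans_lt hxy, hyb⟩))

theorem left_le_slope (h : HasOneSidedDerivs γ γR γL a b) (hconv : ConvexOn ℝ (Icc a b) γ)
    (hax : a < x) (hxy : x < y) (hyb : y ≤ b) : γL x ≤ slope γ x y := by
  have hxb : x ≤ b := hxy.le.trans hyb
  refine le_of_tendsto ((hasDerivWithinAt_iff_tendsto_slope' self_notMem_Iio).1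
    (h.hasDerivWithinAt_Iio ⟨hax, hxb⟩)) ?_
  filter_upwards [Ico_mem_nhdsLT hax] with w hw
  exact hconv.slope_mono ⟨hax.le, hxb⟩ ⟨⟨hw.1, hw.2.le.trans hxb⟩, hw.2.ne⟩
    ⟨⟨hax.le.trans hxy.le, hyb⟩, hxy.ne'⟩ (hw.2.le.trans hxy.le)

/-- A lower bound for the left derivative to the right of `x` bounds the right derivative at `x`. -/
theorem le_right_of_forall_le_left (h : HasOneSidedDerivs γ γR γL a b)
    (hconv : ConvexOn ℝ (Icc a b) γ) (hx : x ∈ Ico a b)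
    (hc : ∀ y ∈ Ioo x b, c ≤ γL y) : c ≤ γR x := by
  have hcont : ContinuousWithinAt γ (Ioi x) x := (h.hasDerivWithinAt_Ioi hx).continuousWithinAt
  have hslope : ∀ z ∈ Ioo x b, c ≤ slope γ x z := by
    intro z hz
    have hlim : Tendsto (fun y ↦ slope γ y z) (𝓝[>] x) (𝓝 (slope γ x z)) := by
      simp only [slope_def_field]
      have hid : Tendsto (fun y : ℝ ↦ y) (𝓝[>] x) (𝓝 x) := nhdsWithin_le_nhds
      exact (hcont.tendsto.const_sub _).div (hid.const_sub _) (sub_pos.2 hz.1).ne'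
    refine ge_of_tendsto hlim ?_
    filter_upwards [Ioo_mem_nhdsGT hz.1] with y hy
    exact (hc y ⟨hy.1, hy.2.trans hz.2⟩).trans
      (h.left_le_slope hconv (hx.1.trans_lt hy.1) hy.2 hz.2.le)
  refine ge_of_tendsto ((hasDerivWithinAt_iff_tendsto_slope' self_notMem_Ioi).1
    (h.hasDerivWithinAt_Ioi hx)) ?_
  filter_upwards [Ioo_mem_nhdsGT hx.2] with z hz using hslope z hz

end HasOneSidedDerivs

theorem statement_3 (γ γR γL : ℝ → ℝ)
    (hconv : ConvexOn ℝ (Icc (0:ℝ) 1) γ)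
    (hderiv : HasOneSidedDerivs γ γR γL 0 1)
    (h0 : 0 ≤ γR 0) (h01 : γR 0 ≤ γL 1) (h1 : γL 1 ≤ 1)
    (δ : ℝ) (hδ0 : 0 < δ) (hδ1 : δ ≤ 1)
    (P : ℕ) (hP : 2 ≤ P)
    (s : ℕ → ℝ) (hs0 : s 0 = 0) (hsP : s P = 1)
    (hmono : ∀ p, p < P → s p < s (p + 1))
    (hA : ∀ p ≤ P - 2, ∀ η : ℝ, 0 < η → s (p + 1) + η ≤ 1 →
      δ < segA γR γL (s p) (s (p + 1) + η)) :
    ((P : ℝ) - 1) * δ ≤ 2 ∧ (P : ℝ) ≤ 3 / δ := by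
  have hlt : ∀ p < P, s p < 1 := by
    intro p hp
    have hstrict : StrictMonoOn s (Iic P) :=
      strictMonoOn_of_lt_add_one ordConnected_Iic fun p _ _ hp ↦ hmono p hp
    exact hsP ▸ hstrict hp.le self_mem_Iic hp
  have key : ∀ p < P, 0 ≤ s p ∧ p * δ ≤ γR (s p) := by
    intro p
    induction p with
    | zero => intro _; simpa [hs0] using h0
    | succ p ih =>
      intro hp
      obtain ⟨hsp, hγ⟩ := ih (by omega)
      have hstep := hmono p (by omega)
      refine ⟨hsp.trans hstep.le,
        hderiv.le_right_of_forall_le_left hconv ⟨hsp.trans hstep.le, hlt _ hp⟩ fun y hy ↦ ?_⟩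
      have hA' := hA p (by omega) (y - s (p + 1)) (sub_pos.2 hy.1) (by linarith [hy.2])
      rw [add_sub_cancel, segA] at hA'
      have hR : 0 ≤ γR (s p) := le_trans (by positivity) hγ
      have hL : 0 ≤ γL y :=
        hR.trans (hderiv.right_le_left hconv hsp (hstep.trans hy.1) hy.2.le)
      have hprod : 0 ≤ γL y * γR (s p) := mul_nonneg hL hR
      rw [lt_div_iff₀ (by linarith)] at hA'
      push_cast
      nlinarith [mul_nonneg hδ0.le hprod]
  obtain ⟨hsp, hγ⟩ := key (P - 1) (by omega)
  have hle := hderiv.right_le_left hconv hsp (hlt (P - 1) (by omega)) le_rfl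
  rw [Nat.cast_sub (by omega), Nat.cast_one] at hγ
  refine ⟨by linarith, ?_⟩
  rw [le_div_iff₀ hδ0]
  linarith
end

section
/- Let R ≥ 1, ε ∈ (0,1/2), and let γ : [0,1] → ℝ be convex with 0 ≤ γ'_R(0) ≤ γ'_L(1) ≤ 1. Let 0 ≤ s < s' ≤ 1 satisfy A(Γ,[s,s']) ≤ R^{−2ε}, set r := R^{2ε}/L(Γ,[s,s']), and define the similarity 𝓛(ξ) := (r/(1+γ'_R(s)²)^{1/2})·M·(ξ − Γ(s)), where M is the 2×2 matrix with rows (1, γ'_R(s)) and (−γ'_R(s), 1). Then there exist b̃ > 0 and a convex function γ̃ : [0,b̃] → ℝ such that 𝓛({(t,γ(t)) : t ∈ [s,s']}) = {(t, γ̃(t)) : t ∈ [0,b̃]}, the pair (γ̃,[0,b̃]) is admissible with parameters R, ε, and moreover L(Γ̃,[0,b̃]) = R^{2ε}, i.e. condition (C2) holds with equality. -/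
open Set

/-- `segL γ a b` is `L(Γ,[a,b]) = ‖Γ(b) − Γ(a)‖` with `Γ(t) = (t, γ t)` (Euclidean norm). -/
noncomputable def segL (γ : ℝ → ℝ) (a b : ℝ) : ℝ :=
  Real.sqrt ((b - a) ^ 2 + (γ b - γ a) ^ 2)

/-- `segW γ γR γL a b` is `W(Γ,[a,b]) = L(Γ,[a,b])·A(Γ,[a,b])`. -/
noncomputable def segW (γ γR γL : ℝ → ℝ) (a b : ℝ) : ℝ :=
  segL γ a b * segA γR γL a b

/-- The pair `(γ,[a,b])` is admissible with parameters `R, ε`: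
γ is convex on `[a,b]` with one-sided derivatives `γR, γL`, and
(C1) `A(Γ,[a,b]) ≤ R^{−2ε}`; (C2) `L(Γ,[a,b]) ≥ R^{2ε}`;
(C3) `γ(a) = 0` and `γ'_R(a) = 0`; (C4) `W(Γ,[a,b]) ≤ 1`. -/
noncomputable def AdmissiblePair (R ε : ℝ) (γ γR γL : ℝ → ℝ) (a b : ℝ) : Prop :=
  a < b ∧ ConvexOn ℝ (Set.Icc a b) γ ∧ HasOneSidedDerivs γ γR γL a b ∧
  segA γR γL a b ≤ R ^ (-(2 * ε)) ∧
  R ^ (2 * ε) ≤ segL γ a b ∧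
  γ a = 0 ∧ γR a = 0 ∧
  segW γ γR γL a b ≤ 1

open Filter Topology

lemma HasDerivWithinAt.comp_rightInverse {p h q : ℝ → ℝ} {S T : Set ℝ} {x p' h' : ℝ}
    (hx : x ∈ S) (hq : ContinuousWithinAt q S x) (hST : MapsTo q S T)
    (hpq : ∀ u ∈ S, p (q u) = u) (hp : HasDerivWithinAt p p' T (q x))
    (hh : HasDerivWithinAt h h' T (q x)) (hp' : p' ≠ 0) :
    HasDerivWithinAt (fun u => h (q u)) (h' / p') S x := by
  have hp2 : HasFDerivWithinAt p
      (ContinuousLinearEquiv.unitsEquivAut ℝ (Units.mk0 p' hp') : ℝ →L[ℝ] ℝ) T (q x) :=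
    hp.hasFDerivWithinAt.congr_fderiv (by ext; simp)
  have hq' : HasDerivWithinAt q p'⁻¹ S x := by
    have := HasFDerivWithinAt.of_local_left_inverse
      (tendsto_nhdsWithin_of_tendsto_nhds_of_eventually_within q hq
        (eventually_nhdsWithin_of_forall hST)) hp2 hx (eventually_nhdsWithin_of_forall hpq)
    exact this.hasDerivWithinAt.congr_deriv (by simp)
  exact hh.comp x hq' hST

lemma HasOneSidedDerivs.right_Icc {γ γR γL : ℝ → ℝ} {a b x : ℝ}
    (h : HasOneSidedDerivs γ γR γL a b) (hx : x ∈ Ico a b) :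
    HasDerivWithinAt γ (γR x) (Icc x b) x := by
  rw [← Ioc_insert_left hx.2.le]
  exact (h.1 x hx).hasFDerivWithinAt.insert

lemma HasOneSidedDerivs.left_Icc {γ γR γL : ℝ → ℝ} {a b x : ℝ}
    (h : HasOneSidedDerivs γ γR γL a b) (hx : x ∈ Ioc a b) :
    HasDerivWithinAt γ (γL x) (Icc a x) x := by
  rw [← Ico_insert_right hx.1.le]
  exact (h.2 x hx).hasFDerivWithinAt.insert

lemma HasOneSidedDerivs.mono {γ γR γL : ℝ → ℝ} {a b c d : ℝ}
    (h : HasOneSidedDerivs γ γR γL a b) (hac : a ≤ c) (hdb : d ≤ b) :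
    HasOneSidedDerivs γ γR γL c d :=
  ⟨fun x hx => (h.1 x ⟨hac.trans hx.1, hx.2.trans_le hdb⟩).mono (Ioc_subset_Ioc_right hdb),
    fun x hx => (h.2 x ⟨hac.trans_lt hx.1, hx.2.trans hdb⟩).mono (Ico_subset_Ico_left hac)⟩

lemma HasOneSidedDerivs.continuousOn {γ γR γL : ℝ → ℝ} {a b : ℝ} (hab : a < b)
    (h : HasOneSidedDerivs γ γR γL a b) : ContinuousOn γ (Icc a b) := by
  intro x hx
  rcases hx.1.eq_or_lt with rfl | hax
  · exact (h.right_Icc ⟨le_rfl, hab⟩).continuousWithinAt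
  rcases hx.2.eq_or_lt with rfl | hxb
  · exact (h.left_Icc ⟨hab, le_rfl⟩).continuousWithinAt
  rw [← Icc_union_Icc_eq_Icc hx.1 hx.2]
  exact (h.left_Icc ⟨hax, hx.2⟩).continuousWithinAt.union
    (h.right_Icc ⟨hx.1, hxb⟩).continuousWithinAt

lemma ConvexOn.monotoneOn_of_rightDeriv_nonneg {γ γR γL : ℝ → ℝ} {a b : ℝ} (hab : a < b)
    (hconv : ConvexOn ℝ (Icc a b) γ) (h : HasOneSidedDerivs γ γR γL a b) (h0 : 0 ≤ γR a) :
    MonotoneOn γ (Icc a b) := by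
  have haI : a ∈ Icc a b := ⟨le_rfl, hab.le⟩
  have hmin : ∀ y ∈ Icc a b, γ a ≤ γ y := by
    intro y hy
    rcases hy.1.eq_or_lt with rfl | hay
    · rfl
    have hd : HasDerivWithinAt γ (γR a) (Ioi a) a :=
      (h.1 a ⟨le_rfl, hab⟩).mono_of_mem_nhdsWithin (Ioc_mem_nhdsGT hab)
    have := h0.trans (hconv.le_slope_of_hasDerivWithinAt_Ioi haI hy hay hd)
    rw [slope_def_field] at this
    have h2 := (le_div_iff₀ (sub_pos.2 hay)).1 this
    linarith
  intro x hx y hy hxy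
  simpa [max_eq_right (hmin y hy)] using hconv.le_max_of_mem_Icc haI hy ⟨hx.1, hxy⟩

lemma HasOneSidedDerivs.right_nonneg {γ γR γL : ℝ → ℝ} {a b x : ℝ}
    (h : HasOneSidedDerivs γ γR γL a b) (hm : MonotoneOn γ (Icc a b)) (hx : x ∈ Ico a b) :
    0 ≤ γR x := by
  have hd : HasDerivWithinAt γ (γR x) (Ioo x b) x := (h.1 x hx).mono Ioo_subset_Ioc_self
  have := (hasDerivWithinAt_iff_tendsto_slope' (by simp)).1 hd
  have : (𝓝[Ioo x b] x).NeBot := left_nhdsWithin_Ioo_neBot hx.2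
  refine ge_of_tendsto ‹Tendsto _ _ _› (eventually_nhdsWithin_of_forall fun y hy => ?_)
  rw [slope_def_field]
  exact div_nonneg (sub_nonneg.2 (hm ⟨hx.1, hx.2.le⟩ ⟨hx.1.trans hy.1.le, hy.2.le⟩ hy.1.le))
    (sub_nonneg.2 hy.1.le)

lemma HasOneSidedDerivs.left_nonneg {γ γR γL : ℝ → ℝ} {a b x : ℝ}
    (h : HasOneSidedDerivs γ γR γL a b) (hm : MonotoneOn γ (Icc a b)) (hx : x ∈ Ioc a b) :
    0 ≤ γL x := by
  have hd : HasDerivWithinAt γ (γL x) (Ioo a x) x := (h.2 x hx).mono Ioo_subset_Ico_self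
  have := (hasDerivWithinAt_iff_tendsto_slope' (by simp)).1 hd
  have : (𝓝[Ioo a x] x).NeBot := right_nhdsWithin_Ioo_neBot hx.1
  refine ge_of_tendsto ‹Tendsto _ _ _› (eventually_nhdsWithin_of_forall fun y hy => ?_)
  rw [slope_def_field, ← neg_div_neg_eq]
  exact div_nonneg (by linarith [hm ⟨hy.1.le, hy.2.le.trans hx.2⟩ ⟨hx.1.le, hx.2⟩ hy.2.le])
    (by linarith [hy.2])

/-- The image of the graph of a monotone convex function under the clockwise similarity of ratio
`c * √(1 + g ^ 2)` and angle `arctan g`, based at the left end of the graph, is the graph of a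
convex function. -/
lemma exists_convexOn_similarity {γ γR γL : ℝ → ℝ} {a b c g : ℝ} (hab : a < b) (hc : 0 < c)
    (hg : 0 ≤ g) (hconv : ConvexOn ℝ (Icc a b) γ) (hm : MonotoneOn γ (Icc a b))
    (h : HasOneSidedDerivs γ γR γL a b) :
    ∃ B : ℝ, ∃ f q : ℝ → ℝ, 0 < B ∧ B = c * ((b - a) + g * (γ b - γ a)) ∧ q 0 = a ∧ q B = b ∧
      f 0 = 0 ∧ f B = c * (-g * (b - a) + (γ b - γ a)) ∧
      (fun ξ : ℝ × ℝ => (c * ((ξ.1 - a) + g * (ξ.2 - γ a)), c * (-g * (ξ.1 - a) + (ξ.2 - γ a)))) ''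
        {p : ℝ × ℝ | ∃ t ∈ Icc a b, p = (t, γ t)} = {p : ℝ × ℝ | ∃ t ∈ Icc 0 B, p = (t, f t)} ∧
      ConvexOn ℝ (Icc 0 B) f ∧
      HasOneSidedDerivs f (fun u => (γR (q u) - g) / (1 + γR (q u) * g))
        (fun u => (γL (q u) - g) / (1 + γL (q u) * g)) 0 B := by
  have haI : a ∈ Icc a b := ⟨le_rfl, hab.le⟩
  have hbI : b ∈ Icc a b := ⟨hab.le, le_rfl⟩
  obtain ⟨p, hp⟩ : ∃ p : ℝ → ℝ, ∀ t, p t = c * ((t - a) + g * (γ t - γ a)) := ⟨_, fun _ => rfl⟩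
  obtain ⟨k, hk⟩ : ∃ k : ℝ → ℝ, ∀ t, k t = c * (-g * (t - a) + (γ t - γ a)) := ⟨_, fun _ => rfl⟩
  have hexp : ∀ t ∈ Icc a b, ∀ u ∈ Icc a b, t ≤ u → c * (u - t) ≤ p u - p t := by
    intro t ht u hu htu
    have := mul_nonneg hc.le (mul_nonneg hg (sub_nonneg.2 (hm ht hu htu)))
    rw [hp, hp]
    linarith
  have hmono : StrictMonoOn p (Icc a b) := fun t ht u hu htu => by
    have := hexp t ht u hu htu.le
    have := mul_pos hc (sub_pos.2 htu)
    linarith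
  have hpa : p a = 0 := by simp [hp]
  have hcont : ContinuousOn p (Icc a b) := by
    have := h.continuousOn hab
    rw [funext hp]
    fun_prop
  have hmaps : ∀ t ∈ Icc a b, p t ∈ Icc 0 (p b) := fun t ht =>
    ⟨hpa ▸ hmono.monotoneOn haI ht ht.1, hmono.monotoneOn ht hbI ht.2⟩
  have hsurj : SurjOn p (Icc a b) (Icc 0 (p b)) := by
    have := intermediate_value_Icc hab.le hcont
    rwa [hpa] at this
  obtain ⟨q, hq⟩ : ∃ q, q = Function.invFunOn p (Icc a b) := ⟨_, rfl⟩
  have hqI : ∀ u ∈ Icc 0 (p b), q u ∈ Icc a b := fun u hu =>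
    hq ▸ Function.invFunOn_mem (hsurj hu)
  have hpq : ∀ u ∈ Icc 0 (p b), p (q u) = u := fun u hu =>
    hq ▸ Function.invFunOn_eq (hsurj hu)
  have hqp : ∀ t ∈ Icc a b, q (p t) = t := fun t ht =>
    hmono.injOn (hqI _ (hmaps t ht)) ht (hpq _ (hmaps t ht))
  have hB : 0 < p b := hpa ▸ hmono haI hbI hab
  have hq0 : q 0 = a := hpa ▸ hqp a haI
  have hqmono : MonotoneOn q (Icc 0 (p b)) := fun u hu v hv huv => by
    rw [← hmono.le_iff_le (hqI u hu) (hqI v hv), hpq u hu, hpq v hv]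
    exact huv
  have hqcont : ContinuousOn q (Icc 0 (p b)) := by
    refine (LipschitzOnWith.of_le_add_mul' c⁻¹ fun u hu v hv => ?_).continuousOn
    rcases le_total u v with huv | hvu
    · have := hqmono hu hv huv
      have : 0 ≤ c⁻¹ * dist u v := mul_nonneg (inv_nonneg.2 hc.le) dist_nonneg
      linarith
    · have := hexp _ (hqI v hv) _ (hqI u hu) (hqmono hv hu hvu)
      rw [hpq u hu, hpq v hv] at this
      rw [Real.dist_eq, abs_of_nonneg (sub_nonneg.2 hvu), inv_mul_eq_div, ← sub_le_iff_le_add',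
        le_div_iff₀ hc]
      linarith
  have hderivp : ∀ {S : Set ℝ} {t m : ℝ}, HasDerivWithinAt γ m S t →
      HasDerivWithinAt p (c * (1 + m * g)) S t := by
    intro S t m hd
    rw [funext hp, mul_comm m]
    exact (((hasDerivWithinAt_id t S).sub_const a).add
      ((hd.sub_const _).const_mul g)).const_mul c
  have hderivk : ∀ {S : Set ℝ} {t m : ℝ}, HasDerivWithinAt γ m S t →
      HasDerivWithinAt k (c * (m - g)) S t := by
    intro S t m hd
    rw [funext hk]
    exact (((((hasDerivWithinAt_id t S).sub_const a).const_mul (-g)).add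
      (hd.sub_const (γ a))).const_mul c).congr_deriv (by ring)
  have hpos : ∀ {m : ℝ}, 0 ≤ m → 0 < 1 + m * g := fun hm => by positivity
  refine ⟨p b, fun u => k (q u), q, hB, hp b, hq0, hqp b hbI, by simp [hq0, hk],
    by simp only [hqp b hbI, hk], ?_, ?_, ?_, ?_⟩
  · ext z
    simp only [mem_image, mem_ofPred_eq]
    constructor
    · rintro ⟨_, ⟨t, ht, rfl⟩, rfl⟩
      exact ⟨p t, hmaps t ht, by rw [hqp t ht, hp, hk]⟩
    · rintro ⟨u, hu, rfl⟩
      exact ⟨_, ⟨q u, hqI u hu, rfl⟩, by rw [← hp, ← hk, hpq u hu]⟩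
  · refine ⟨convex_Icc _ _, fun u hu v hv α β hα hβ hαβ => ?_⟩
    have hw := convex_Icc 0 (p b) hu hv hα hβ hαβ
    have hT := convex_Icc a b (hqI u hu) (hqI v hv) hα hβ hαβ
    have hY := hconv.2 (hqI u hu) (hqI v hv) hα hβ hαβ
    have hpw := hpq _ hw
    have hpu := hpq u hu
    have hpv := hpq v hv
    have hwI := hqI _ hw
    simp only [smul_eq_mul] at *
    set t := q (α * u + β * v)
    obtain ⟨T, hTdef⟩ : ∃ T, T = α * q u + β * q v := ⟨_, rfl⟩
    obtain ⟨Y, hYdef⟩ : ∃ Y, Y = α * γ (q u) + β * γ (q v) := ⟨_, rfl⟩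
    rw [← hTdef] at hT hY
    rw [← hYdef] at hY
    have hβα : β = 1 - α := by linarith
    have hpt : p t = c * ((T - a) + g * (Y - γ a)) := by
      rw [hpw]
      conv_lhs => rw [← hpu, ← hpv, hp, hp]
      rw [hTdef, hYdef, hβα]
      ring
    have hRHS : α * k (q u) + β * k (q v) = c * (-g * (T - a) + (Y - γ a)) := by
      rw [hk, hk, hTdef, hYdef, hβα]
      ring
    have hTt : T ≤ t := by
      rw [← hmono.le_iff_le hT hwI, hpt, hp]
      gcongr
    have hsum : t + g * γ t = T + g * Y := by
      rw [hp] at hpt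
      have := mul_left_cancel₀ hc.ne' hpt
      linarith
    rw [hRHS, hk]
    refine mul_le_mul_of_nonneg_left ?_ hc.le
    have hgT := mul_le_mul_of_nonneg_left hTt hg
    rcases hg.eq_or_lt with hg0 | hg0
    · have : t = T := by simpa [← hg0] using hsum
      rw [this]
      linarith
    · have : γ t ≤ Y := le_of_mul_le_mul_left (by linarith) hg0
      linarith
  · intro u hu
    have huI : u ∈ Icc 0 (p b) := ⟨hu.1, hu.2.le⟩
    have hqu : q u ∈ Ico a b := ⟨(hqI u huI).1, by
      rw [← hmono.lt_iff_lt (hqI u huI) hbI, hpq u huI]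
      exact hu.2⟩
    have hsub : Icc u (p b) ⊆ Icc 0 (p b) := Icc_subset_Icc_left hu.1
    have hd := h.right_Icc hqu
    have hne := (hpos (h.right_nonneg hm hqu)).ne'
    have := HasDerivWithinAt.comp_rightInverse (S := Icc u (p b)) (T := Icc (q u) b) ⟨le_rfl, hu.2.le⟩
      ((hqcont u huI).mono hsub) (fun v hv => ⟨hqmono huI (hsub hv) hv.1, (hqI v (hsub hv)).2⟩)
      (fun v hv => hpq v (hsub hv)) (hderivp hd) (hderivk hd) (mul_ne_zero hc.ne' hne)
    rw [mul_div_mul_left _ _ hc.ne'] at this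
    exact this.mono Ioc_subset_Icc_self
  · intro u hu
    have huI : u ∈ Icc 0 (p b) := ⟨hu.1.le, hu.2⟩
    have hqu : q u ∈ Ioc a b := ⟨by
      rw [← hmono.lt_iff_lt haI (hqI u huI), hpq u huI, hpa]
      exact hu.1, (hqI u huI).2⟩
    have hsub : Icc 0 u ⊆ Icc 0 (p b) := Icc_subset_Icc_right hu.2
    have hd := h.left_Icc hqu
    have hne := (hpos (h.left_nonneg hm hqu)).ne'
    have := HasDerivWithinAt.comp_rightInverse (S := Icc 0 u) (T := Icc a (q u)) ⟨hu.1.le, le_rfl⟩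
      ((hqcont u huI).mono hsub) (fun v hv => ⟨(hqI v (hsub hv)).1, hqmono (hsub hv) huI hv.2⟩)
      (fun v hv => hpq v (hsub hv)) (hderivp hd) (hderivk hd) (mul_ne_zero hc.ne' hne)
    rw [mul_div_mul_left _ _ hc.ne'] at this
    exact this.mono Ico_subset_Icc_self

theorem statement_9 (R ε s s' : ℝ) (γ γR γL : ℝ → ℝ)
    (hR : 1 ≤ R) (hε : ε ∈ Ioo (0:ℝ) (1/2))
    (hconv : ConvexOn ℝ (Icc (0:ℝ) 1) γ)
    (hderiv : HasOneSidedDerivs γ γR γL 0 1)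
    (h0 : 0 ≤ γR 0) (h01 : γR 0 ≤ γL 1) (h1 : γL 1 ≤ 1)
    (hs : 0 ≤ s) (hss' : s < s') (hs'1 : s' ≤ 1)
    (hA : segA γR γL s s' ≤ R ^ (-(2 * ε))) :
    ∃ (b' : ℝ) (γ' γ'R γ'L : ℝ → ℝ), 0 < b' ∧
      (fun ξ : ℝ × ℝ =>
          (R ^ (2 * ε) / segL γ s s' / Real.sqrt (1 + γR s ^ 2) *
             ((ξ.1 - s) + γR s * (ξ.2 - γ s)),
           R ^ (2 * ε) / segL γ s s' / Real.sqrt (1 + γR s ^ 2) *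
             (-(γR s) * (ξ.1 - s) + (ξ.2 - γ s)))) ''
        {p : ℝ × ℝ | ∃ t ∈ Icc s s', p = (t, γ t)} =
        {p : ℝ × ℝ | ∃ t ∈ Icc 0 b', p = (t, γ' t)} ∧
      AdmissiblePair R ε γ' γ'R γ'L 0 b' ∧
      segL γ' 0 b' = R ^ (2 * ε) := by
  have hm01 := hconv.monotoneOn_of_rightDeriv_nonneg one_pos hderiv h0
  have hsub : Icc s s' ⊆ Icc 0 1 := Icc_subset_Icc hs hs'1
  have hg : 0 ≤ γR s := hderiv.right_nonneg hm01 ⟨hs, hss'.trans_le hs'1⟩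
  have hR0 : 0 < R := one_pos.trans_le hR
  have hr : 0 < R ^ (2 * ε) := Real.rpow_pos_of_pos hR0 _
  have hL : 0 < segL γ s s' := Real.sqrt_pos.2 (by have := sub_pos.2 hss'; positivity)
  have hN : 0 < Real.sqrt (1 + γR s ^ 2) := Real.sqrt_pos.2 (by positivity)
  have hc : 0 < R ^ (2 * ε) / segL γ s s' / Real.sqrt (1 + γR s ^ 2) := by positivity
  obtain ⟨B, f, q, hB, hBeq, hq0, hqB, hf0, hfB, himg, hf, hfd⟩ :=
    exists_convexOn_similarity hss' hc hg (hconv.subset hsub (convex_Icc _ _)) (hm01.mono hsub)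
      (hderiv.mono hs hs'1)
  have hlen : segL f 0 B = R ^ (2 * ε) := by
    have hN2 := Real.sq_sqrt (show 0 ≤ 1 + γR s ^ 2 by positivity)
    have hL2 : segL γ s s' ^ 2 = (s' - s) ^ 2 + (γ s' - γ s) ^ 2 := Real.sq_sqrt (by positivity)
    rw [segL, Real.sqrt_eq_iff_eq_sq (by positivity) hr.le, hf0, hfB, hBeq]
    have key : ∀ c x y g : ℝ, (c * (x + g * y) - 0) ^ 2 + (c * (-g * x + y) - 0) ^ 2 =
        c ^ 2 * ((1 + g ^ 2) * (x ^ 2 + y ^ 2)) := by intros; ring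
    rw [key, ← hL2, div_pow, hN2]
    field_simp
  have hAeq : segA (fun u => (γR (q u) - γR s) / (1 + γR (q u) * γR s))
      (fun u => (γL (q u) - γR s) / (1 + γL (q u) * γR s)) 0 B = segA γR γL s s' := by
    simp [segA, hq0, hqB]
  refine ⟨B, f, _, _, hB, himg, ⟨hB, hf, hfd, hAeq.trans_le hA, hlen.ge, hf0, by simp [hq0], ?_⟩,
    hlen⟩
  rw [segW, hlen, hAeq]
  calc R ^ (2 * ε) * segA γR γL s s' ≤ R ^ (2 * ε) * R ^ (-(2 * ε)) := by gcongr
    _ = 1 := by rw [← Real.rpow_add hR0]; simp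
end

section
/- Let γ be convex and nondecreasing on an interval I (with finite one-sided derivatives at all relevant points), let t¹ < t² < v² < t⁴ be points of I, and let ρ, λ > 0. Assume L(Γ,[t²,v²]) ≤ 2λ and that W(Γ,[t², v²+η]) > ρ for every η > 0 with v² + η ≤ t⁴. Then γ'_R(t⁴) − γ'_R(t¹) ≥ ρ/(2λ). -/
open Set

open Filter Topology

/-- A left derivative at `x` of a convex function is at most every slope to the right of `x`. -/
lemma ConvexOn.le_slope_of_hasDerivWithinAt_Ico {f : ℝ → ℝ} {S : Set ℝ} {f' a x y : ℝ}
    (hf : ConvexOn ℝ S f) (ha : a ∈ S) (hy : y ∈ S) (hax : a < x) (hxy : x < y)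
    (hf' : HasDerivWithinAt f f' (Ico a x) x) : f' ≤ slope f x y := by
  have hx : x ∈ S := hf.1.ordConnected.out ha hy ⟨hax.le, hxy.le⟩
  have hlim := (hasDerivWithinAt_iff_tendsto_slope' (by simp)).mp hf'
  have : (𝓝[Ico a x] x).NeBot := by
    rw [nhdsWithin_Ico_eq_nhdsLT hax]
    infer_instance
  refine le_of_tendsto hlim ?_
  filter_upwards [self_mem_nhdsWithin] with t ht
  exact hf.slope_mono hx ⟨hf.1.ordConnected.out ha hx ⟨ht.1, ht.2.le⟩, ht.2.ne⟩
    ⟨hy, hxy.ne'⟩ (ht.2.trans hxy).le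

/-- A right derivative at `y` of a convex function is at least every slope to the left of `y`. -/
lemma ConvexOn.slope_le_of_hasDerivWithinAt_Ioc {f : ℝ → ℝ} {S : Set ℝ} {f' b x y : ℝ}
    (hf : ConvexOn ℝ S f) (hx : x ∈ S) (hb : b ∈ S) (hxy : x < y) (hyb : y < b)
    (hf' : HasDerivWithinAt f f' (Ioc y b) y) : slope f x y ≤ f' := by
  have hy : y ∈ S := hf.1.ordConnected.out hx hb ⟨hxy.le, hyb.le⟩
  have hlim := (hasDerivWithinAt_iff_tendsto_slope' (by simp)).mp hf'
  have : (𝓝[Ioc y b] y).NeBot := by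
    rw [nhdsWithin_Ioc_eq_nhdsGT hyb]
    infer_instance
  rw [slope_comm]
  refine ge_of_tendsto hlim ?_
  filter_upwards [self_mem_nhdsWithin] with t ht
  exact hf.slope_mono hy ⟨hx, hxy.ne⟩
    ⟨hf.1.ordConnected.out hy hb ⟨ht.1.le, ht.2⟩, ht.1.ne'⟩ (hxy.trans ht.1).le

lemma segL_nonneg (γ : ℝ → ℝ) (a b : ℝ) : 0 ≤ segL γ a b := Real.sqrt_nonneg _

/-- With nonnegative slopes, the quotient defining `segA` is at most its numerator. -/
lemma segA_le_sub {γR γL : ℝ → ℝ} {a b : ℝ} (h₀ : 0 ≤ γR a) (h : γR a ≤ γL b) :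
    segA γR γL a b ≤ γL b - γR a :=
  div_le_self (sub_nonneg.2 h) (le_add_of_nonneg_right (mul_nonneg (h₀.trans h) h₀))

theorem statement_11 (a b t₁ t₂ v₂ t₄ ρ lam : ℝ) (γ γR γL : ℝ → ℝ)
    (hconv : ConvexOn ℝ (Icc a b) γ) (hmono : MonotoneOn γ (Icc a b))
    (hderiv : HasOneSidedDerivs γ γR γL a b)
    (ht₁ : t₁ ∈ Ico a b) (ht₄ : t₄ ∈ Ico a b)
    (h12 : t₁ < t₂) (h2v : t₂ < v₂) (hv4 : v₂ < t₄)
    (hρ : 0 < ρ) (hlam : 0 < lam)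
    (hlen : segL γ t₂ v₂ ≤ 2 * lam)
    (hsep : ∀ η : ℝ, 0 < η → v₂ + η ≤ t₄ → ρ < segW γ γR γL t₂ (v₂ + η)) :
    ρ / (2 * lam) ≤ γR t₄ - γR t₁ := by
  obtain ⟨hR, hL⟩ := hderiv
  have hR' : ∀ x ∈ Ico a b, HasDerivWithinAt γ (γR x) (Ioi x) x := fun x hx ↦
    (hR x hx).mono_of_mem_nhdsWithin (Ioc_mem_nhdsGT hx.2)
  have hL' : ∀ x ∈ Ioc a b, HasDerivWithinAt γ (γL x) (Iio x) x := fun x hx ↦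
    (hL x hx).mono_of_mem_nhdsWithin (Ico_mem_nhdsLT hx.1)
  obtain ⟨ha₁, -⟩ := ht₁
  obtain ⟨-, h₄b⟩ := ht₄
  have m₁ : t₁ ∈ Icc a b := ⟨ha₁, by linarith⟩
  have m₂ : t₂ ∈ Icc a b := ⟨by linarith, by linarith⟩
  have m₄ : t₄ ∈ Icc a b := ⟨by linarith, h₄b.le⟩
  have ma : a ∈ Icc a b := ⟨le_rfl, by linarith⟩
  have mb : b ∈ Icc a b := ⟨by linarith, le_rfl⟩
  have hs : slope γ t₁ t₂ ≤ γR t₂ :=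
    hconv.slope_le_of_hasDerivWithinAt_Ioc m₁ mb h12 (by linarith) (hR t₂ ⟨m₂.1, by linarith⟩)
  have hR₁₂ : γR t₁ ≤ γR t₂ :=
    (hconv.le_slope_of_hasDerivWithinAt_Ioi m₁ m₂ h12 (hR' t₁ ⟨ha₁, by linarith⟩)).trans hs
  have hR₂ : 0 ≤ γR t₂ := by
    refine le_trans ?_ hs
    rw [slope_def_field]
    exact div_nonneg (sub_nonneg.2 (hmono m₁ m₂ h12.le)) (sub_nonneg.2 h12.le)
  have key : ∀ x ∈ Ioo v₂ t₄, ρ ≤ segL γ t₂ x * (γR t₄ - γR t₁) := by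
    rintro x ⟨hvx, hx₄⟩
    have mx : x ∈ Icc a b := ⟨by linarith [m₂.1], by linarith⟩
    have hax : a < x := by linarith [m₂.1]
    have hRL : γR t₂ ≤ γL x :=
      (hconv.le_slope_of_hasDerivWithinAt_Ioi m₂ mx (by linarith)
        (hR' t₂ ⟨m₂.1, by linarith⟩)).trans
        (hconv.slope_le_of_hasDerivWithinAt_Iio m₂ mx (by linarith) (hL' x ⟨hax, mx.2⟩))
    have hLR : γL x ≤ γR t₄ :=
      (hconv.le_slope_of_hasDerivWithinAt_Ico ma m₄ hax hx₄ (hL x ⟨hax, mx.2⟩)).trans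
        (hconv.slope_le_of_hasDerivWithinAt_Ioc mx mb hx₄ h₄b (hR t₄ ⟨m₄.1, h₄b⟩))
    have hW := hsep (x - v₂) (by linarith) (by linarith)
    rw [add_sub_cancel, segW] at hW
    refine hW.le.trans (mul_le_mul_of_nonneg_left ?_ (segL_nonneg γ t₂ x))
    linarith [segA_le_sub hR₂ hRL]
  have hγ : Tendsto γ (𝓝[>] v₂) (𝓝 (γ v₂)) :=
    (hR' v₂ ⟨by linarith [m₂.1], by linarith⟩).continuousWithinAt
  have hid : Tendsto (fun x : ℝ ↦ x) (𝓝[>] v₂) (𝓝 v₂) := nhdsWithin_le_nhds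
  have hlim : Tendsto (fun x ↦ segL γ t₂ x * (γR t₄ - γR t₁)) (𝓝[>] v₂)
      (𝓝 (segL γ t₂ v₂ * (γR t₄ - γR t₁))) :=
    ((((hid.sub_const t₂).pow 2).add ((hγ.sub_const (γ t₂)).pow 2)).sqrt).mul_const _
  have hbound : ρ ≤ segL γ t₂ v₂ * (γR t₄ - γR t₁) :=
    ge_of_tendsto hlim (eventually_of_mem (Ioo_mem_nhdsGT hv4) key)
  have hpos : 0 ≤ γR t₄ - γR t₁ :=
    (pos_of_mul_pos_right (hρ.trans_le hbound) (segL_nonneg γ t₂ v₂)).le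
  rw [div_le_iff₀ (by positivity), mul_comm]
  exact hbound.trans (mul_le_mul_of_nonneg_right hlen hpos)
end
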